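/- arXiv:2302.08335 — 4 statements merged into one kernel-verified Lean document; each statement's English description precedes it below -/
import Mathlib

section
/- Let h, a, c > 0 and set a_p = a + h^2, c_p = c + 1, k = c/(a + c·a_p), γ = 2 + k, β = k·h. Suppose Ψ : J → ℝ is twice differentiable and Θ : J → ℝ is differentiable on an open interval J ⊆ (0, π), and that for all φ ∈ J they satisfy Ψ'(φ)·sin φ = k·c_p·Θ(φ) + ((k·c_p − 2)·cos φ − h·k·sin φ)·Ψ(φ) and Θ'(φ)·sin φ = (−k·c_p·cos φ + h·k·sin φ)·Θ(φ) + (−k·c_p·cos²φ − k·a_p·sin²φ + h·k·sin 2φ + 2)·Ψ(φ). Then Ψ satisfies the second-order ODE Ψ''(φ) + 3·cot φ·Ψ'(φ) − (γ + β·cot φ)·Ψ(φ) = 0 for all φ ∈ J. -/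
open Real

/-- Reduction of the rolling-can first-order system for `Ψ, Θ` (as functions of the
nutation angle `φ`) to the single second-order ODE
`Ψ'' + 3 cot φ · Ψ' − (γ + β cot φ) · Ψ = 0`. -/
theorem rocking_can_reduction_to_second_order_ODE
    (h a c : ℝ) (ha : 0 < a) (hc : 0 < c) (hh : 0 < h)
    (a_p c_p k γ β : ℝ)
    (hap : a_p = a + h ^ 2) (hcp : c_p = c + 1)
    (hk : k = c / (a + c * a_p)) (hγ : γ = 2 + k) (hβ : β = k * h)
    (lo hi : ℝ) (J : Set ℝ) (hJ : J = Set.Ioo lo hi)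
    (hJsub : J ⊆ Set.Ioo 0 π)
    (Ψ Ψ' Ψ'' Θ Θ' : ℝ → ℝ)
    (hΨ : ∀ φ ∈ J, HasDerivAt Ψ (Ψ' φ) φ)
    (hΨ' : ∀ φ ∈ J, HasDerivAt Ψ' (Ψ'' φ) φ)
    (hΘ : ∀ φ ∈ J, HasDerivAt Θ (Θ' φ) φ)
    (heq1 : ∀ φ ∈ J, Ψ' φ * Real.sin φ =
      k * c_p * Θ φ + ((k * c_p - 2) * Real.cos φ - h * k * Real.sin φ) * Ψ φ)
    (heq2 : ∀ φ ∈ J, Θ' φ * Real.sin φ =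
      (-(k * c_p) * Real.cos φ + h * k * Real.sin φ) * Θ φ +
        (-(k * c_p) * Real.cos φ ^ 2 - k * a_p * Real.sin φ ^ 2 +
          h * k * Real.sin (2 * φ) + 2) * Ψ φ) :
    ∀ φ ∈ J, Ψ'' φ + 3 * Real.cot φ * Ψ' φ - (γ + β * Real.cot φ) * Ψ φ = 0 := by
  intro φ hφ
  have hs : 0 < Real.sin φ := Real.sin_pos_of_mem_Ioo (hJsub hφ)
  have hnhds : J ∈ nhds φ := by
    rw [hJ] at hφ ⊢
    exact Ioo_mem_nhds hφ.1 hφ.2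
  have hL := (hΨ' φ hφ).mul (Real.hasDerivAt_sin φ)
  have hR := ((hΘ φ hφ).const_mul (k * c_p)).add
    ((((Real.hasDerivAt_cos φ).const_mul (k * c_p - 2)).sub
      ((Real.hasDerivAt_sin φ).const_mul (h * k))).mul (hΨ φ hφ))
  have hR' := hR.congr_of_eventuallyEq (f₁ := Ψ' * Real.sin)
    (Filter.mem_of_superset hnhds (fun x hx => heq1 x hx))
  have hD := hL.unique hR'
  simp only [Pi.sub_apply] at hD
  have e1 := heq1 φ hφ
  have e2 := heq2 φ hφ
  rw [Real.sin_two_mul] at e2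
  have hden : a + c * a_p ≠ 0 := by
    rw [hap]; positivity
  have hkc : k * (a + c * a_p) = c := by
    rw [hk]; field_simp
  have hsc := Real.sin_sq_add_cos_sq φ
  rw [Real.cot_eq_cos_div_sin]
  have key : Real.sin φ ^ 2 * Ψ'' φ + 3 * Real.cos φ * Real.sin φ * Ψ' φ
      - (γ * Real.sin φ ^ 2 + β * Real.cos φ * Real.sin φ) * Ψ φ = 0 := by
    have ha' : a = a_p - h ^ 2 := by linarith
    have hc' : c = c_p - 1 := by linarith
    rw [ha', hc'] at hkc
    rw [hγ, hβ]
    generalize Real.sin φ = s at *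
    generalize Real.cos φ = C at *
    linear_combination s * hD + k * c_p * e2 - (-(k * c_p) * C + h * k * s) * e1
      - k * s ^ 2 * Ψ φ * hkc - 2 * k * c_p * Ψ φ * hsc
  have hs' := hs.ne'
  field_simp
  apply mul_left_cancel₀ hs'
  linear_combination key
end

section
/- Let K, ψ₀ ∈ ℝ and Ω ≠ 0, and suppose x, y : ℝ → ℝ are differentiable with x'(t) = −K·sin(Ω·t + ψ₀) and y'(t) = K·cos(Ω·t + ψ₀) for all t. Then, with centre (x_c, y_c) = (x(0) − (K/Ω)·cos ψ₀, y(0) − (K/Ω)·sin ψ₀), one has (x(t) − x_c)² + (y(t) − y_c)² = (K/Ω)² for all t; i.e. the trajectory lies on a circle of radius |K/Ω|. -/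
open Real

/-- Steady motions of the rolling can move on a circle: if
`x' = −K sin(Ω t + ψ₀)` and `y' = K cos(Ω t + ψ₀)` with `Ω ≠ 0`, then the
trajectory lies on a circle of radius `|K/Ω|` about the stated centre. -/
theorem rocking_can_steady_motion_circle
    (K ψ₀ Ω : ℝ) (hΩ : Ω ≠ 0)
    (x y : ℝ → ℝ)
    (hx : ∀ t, HasDerivAt x (-K * Real.sin (Ω * t + ψ₀)) t)
    (hy : ∀ t, HasDerivAt y (K * Real.cos (Ω * t + ψ₀)) t)
    (x_c y_c : ℝ)
    (hxc : x_c = x 0 - (K / Ω) * Real.cos ψ₀)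
    (hyc : y_c = y 0 - (K / Ω) * Real.sin ψ₀) :
    ∀ t, (x t - x_c) ^ 2 + (y t - y_c) ^ 2 = (K / Ω) ^ 2 := by
  intro t
  have hl : ∀ s, HasDerivAt (fun s : ℝ => Ω * s + ψ₀) Ω s := fun s => by
    simpa using ((hasDerivAt_id s).const_mul Ω).add_const ψ₀
  have h1 : ∀ s, HasDerivAt (fun s => x s - (K / Ω) * Real.cos (Ω * s + ψ₀)) 0 s := fun s => by
    have h := (hx s).sub (((hl s).cos).const_mul (K / Ω))
    refine h.congr_deriv ?_
    field_simp
    ring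
  have h2 : ∀ s, HasDerivAt (fun s => y s - (K / Ω) * Real.sin (Ω * s + ψ₀)) 0 s := fun s => by
    have h := (hy s).sub (((hl s).sin).const_mul (K / Ω))
    refine h.congr_deriv ?_
    field_simp
    ring
  have e1 := is_const_of_deriv_eq_zero (fun s => (h1 s).differentiableAt)
    (fun s => (h1 s).deriv) t 0
  have e2 := is_const_of_deriv_eq_zero (fun s => (h2 s).differentiableAt)
    (fun s => (h2 s).deriv) t 0
  simp only [mul_zero, zero_add] at e1 e2
  have a1 : x t - x_c = (K / Ω) * Real.cos (Ω * t + ψ₀) := by linarith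
  have a2 : y t - y_c = (K / Ω) * Real.sin (Ω * t + ψ₀) := by linarith
  rw [a1, a2]
  linear_combination (K / Ω) ^ 2 * Real.sin_sq_add_cos_sq (Ω * t + ψ₀)
end

section
/- Let a > 0, P ≠ 0, and Q ∈ ℝ. Then the function f(T) = √(P² + (√a·T − Q)²/P²) is twice differentiable on ℝ and satisfies f''(T) = a / f(T)³ for all T ∈ ℝ. -/
open Real

/-- The two-parameter family `f(T) = √(P² + (√a·T − Q)²/P²)` solves the
leading-order inner problem `f'' = a / f³` of the rocking can. -/
theorem rocking_can_inner_solution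
    (a P Q : ℝ) (ha : 0 < a) (hP : P ≠ 0)
    (f : ℝ → ℝ)
    (hf : f = fun T => Real.sqrt (P ^ 2 + (Real.sqrt a * T - Q) ^ 2 / P ^ 2)) :
    Differentiable ℝ f ∧ Differentiable ℝ (deriv f) ∧
      ∀ T, deriv (deriv f) T = a / f T ^ 3 := by
  have hP2 : 0 < P ^ 2 := by positivity
  have hpos : ∀ T : ℝ, 0 < P ^ 2 + (Real.sqrt a * T - Q) ^ 2 / P ^ 2 := fun T => by positivity
  have hfpos : ∀ T, 0 < f T := fun T => by
    rw [hf]; exact Real.sqrt_pos.mpr (hpos T)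
  have hfsq : ∀ T, f T ^ 2 = P ^ 2 + (Real.sqrt a * T - Q) ^ 2 / P ^ 2 := fun T => by
    rw [hf]; exact Real.sq_sqrt (hpos T).le
  have hu : ∀ T, HasDerivAt (fun T : ℝ => Real.sqrt a * T - Q) (Real.sqrt a) T := fun T => by
    simpa using ((hasDerivAt_id T).const_mul (Real.sqrt a)).sub_const Q
  have h1 : ∀ T, HasDerivAt f (Real.sqrt a * (Real.sqrt a * T - Q) / (P ^ 2 * f T)) T := fun T => by
    have h := ((((hu T).pow 2).div_const (P ^ 2)).const_add (P ^ 2)).sqrt (hpos T).ne'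
    have hfT : Real.sqrt (P ^ 2 + (Real.sqrt a * T - Q) ^ 2 / P ^ 2) = f T := by rw [hf]
    have hne := (hfpos T).ne'
    have e : f = fun T => Real.sqrt (P ^ 2 + (Real.sqrt a * T - Q) ^ 2 / P ^ 2) := hf
    have h' : HasDerivAt f (2 * (Real.sqrt a * T - Q) ^ (2 - 1) * Real.sqrt a / P ^ 2 /
        (2 * Real.sqrt (P ^ 2 + (Real.sqrt a * T - Q) ^ 2 / P ^ 2))) T := by
      rw [e]; exact_mod_cast h
    convert h' using 1
    rw [hfT]
    field_simp
    norm_num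
  have hd : deriv f = fun T => Real.sqrt a * (Real.sqrt a * T - Q) / (P ^ 2 * f T) :=
    funext fun T => (h1 T).deriv
  have h2 : ∀ T, HasDerivAt (deriv f) (a / f T ^ 3) T := fun T => by
    have hne := (hfpos T).ne'
    have h := ((hu T).const_mul (Real.sqrt a)).div ((h1 T).const_mul (P ^ 2))
      (mul_ne_zero hP2.ne' hne)
    have hs : Real.sqrt a ^ 2 = a := Real.sq_sqrt ha.le
    have hq : P ^ 2 * f T ^ 2 = P ^ 4 + (Real.sqrt a * T - Q) ^ 2 := by
      rw [hfsq]; field_simp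
    have key : ∀ y u s : ℝ, y ≠ 0 → P ^ 2 * y ^ 2 = P ^ 4 + u ^ 2 →
        s ^ 2 / y ^ 3 = (s * s * (P ^ 2 * y) - s * u * (P ^ 2 * (s * u / (P ^ 2 * y)))) /
          (P ^ 2 * y) ^ 2 := by
      intro y u s hy hq
      field_simp
      linear_combination (-s ^ 2) * hq
    have hk := key (f T) (Real.sqrt a * T - Q) (Real.sqrt a) hne hq
    rw [hs] at hk
    rw [hd, hk]
    exact h
  exact ⟨fun T => (h1 T).differentiableAt, fun T => (h2 T).differentiableAt,
    fun T => (h2 T).deriv⟩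
end

section
/- Let a > 0 and I > 0. Then the function T ↦ √(a + 1)/(a/I + I·T²) is integrable over ℝ and ∫_{−∞}^{∞} √(a + 1)/(a/I + I·T²) dT = π·√((a + 1)/a). -/
open Real MeasureTheory

/-- The angle of turn of the rocking can: integrating the inner precession rate
over all inner time gives `π·√((a+1)/a)`. -/
theorem rocking_can_angle_of_turn_integral
    (a I : ℝ) (ha : 0 < a) (hI : 0 < I) :
    Integrable (fun T : ℝ => Real.sqrt (a + 1) / (a / I + I * T ^ 2)) ∧
      ∫ T : ℝ, Real.sqrt (a + 1) / (a / I + I * T ^ 2) =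
        π * Real.sqrt ((a + 1) / a) := by
  obtain ⟨s, hs, rfl⟩ : ∃ s : ℝ, 0 < s ∧ a = s ^ 2 :=
    ⟨√a, Real.sqrt_pos.2 ha, (Real.sq_sqrt ha.le).symm⟩
  have hc : I / s ≠ 0 := by positivity
  have hf : (fun T : ℝ => Real.sqrt (s ^ 2 + 1) / (s ^ 2 / I + I * T ^ 2)) =
      fun T : ℝ => (Real.sqrt (s ^ 2 + 1) * I / s ^ 2) * (1 + (I / s * T) ^ 2)⁻¹ := by
    funext T
    have h1 : s ^ 2 / I + I * T ^ 2 = s ^ 2 / I * (1 + (I / s * T) ^ 2) := by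
      field_simp
    have h2 : 1 + (I / s * T) ^ 2 ≠ 0 := by positivity
    rw [h1]
    generalize 1 + (I / s * T) ^ 2 = y at h2
    field_simp
  rw [hf]
  constructor
  · exact (integrable_inv_one_add_sq.comp_mul_left' hc).const_mul _
  · rw [integral_const_mul,
      Measure.integral_comp_mul_left (fun x : ℝ => (1 + x ^ 2)⁻¹) (I / s),
      integral_univ_inv_one_add_sq, Real.sqrt_div (by positivity), Real.sqrt_sq hs.le,
      abs_of_pos (by positivity), smul_eq_mul]
    field_simp
end
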